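/- arXiv:2511.06068 — 3 statements merged into one kernel-verified Lean document; each statement's English description precedes it below -/
import Mathlib

section
/- Let 𝔤 be a Lie ring and K ≤ H additive subgroups of 𝔤. Then every element of Ñ_𝔤(H) ∩ Ñ_𝔤(K) normalises the almost centraliser C̃_𝔤(H/K): for all x ∈ Ñ_𝔤(H) ∩ Ñ_𝔤(K) and all c ∈ C̃_𝔤(H/K), one has ⁅x,c⁆ ∈ C̃_𝔤(H/K). In particular, N_𝔤(C̃_𝔤(H/K)) ⊇ Ñ_𝔤(H) ∩ Ñ_𝔤(K). -/
/-- `⁅x, ·⁆` as an additive monoid homomorphism of a Lie ring. -/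
def adHom (L : Type*) [LieRing L] (x : L) : L →+ L :=
  AddMonoidHom.mk' (fun y => ⁅x, y⁆) (lie_add x)

/-- The additive subgroup `⁅x, H⁆ = {⁅x, h⁆ : h ∈ H}` of a Lie ring. -/
def brkt {L : Type*} [LieRing L] (x : L) (H : AddSubgroup L) : AddSubgroup L :=
  H.map (adHom L x)

/-- `A` is almost contained in `B` (written `A ⊆̃ B`): `A ∩ B` has finite index in `A`. -/
def almostLE {G : Type*} [AddGroup G] (A B : AddSubgroup G) : Prop :=
  B.relIndex A ≠ 0

theorem almostLE.trans {G : Type*} [AddGroup G] {A B C : AddSubgroup G}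
    (hAB : almostLE A B) (hBC : almostLE B C) : almostLE A C :=
  AddSubgroup.relIndex_ne_zero_trans hBC hAB

theorem almostLE_brkt_iff {L : Type*} [LieRing L] {x : L} {A B : AddSubgroup L} :
    almostLE (brkt x A) B ↔ almostLE A (B.comap (adHom L x)) := by
  rw [almostLE, almostLE, brkt, AddSubgroup.relIndex_comap]

/-- If `⁅y, A⁆ ⊆̃ B` and `⁅x, B⁆ ⊆̃ C`, then `⁅x, ⁅y, a⁆⁆ ∈ C` for almost all `a ∈ A`. -/
theorem almostLE_comap_comap {L : Type*} [LieRing L] {x y : L} {A B C : AddSubgroup L}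
    (hy : almostLE (brkt y A) B) (hx : almostLE (brkt x B) C) :
    almostLE A ((C.comap (adHom L x)).comap (adHom L y)) :=
  almostLE_brkt_iff.1 (hy.trans (almostLE_brkt_iff.1 hx))

/-- Let `𝔤` be a Lie ring and `K ≤ H` additive subgroups of `𝔤`.  Then every element of
`Ñ_𝔤(H) ∩ Ñ_𝔤(K)` normalises the almost centraliser `C̃_𝔤(H/K) = {x : ⁅x,H⁆ ⊆̃ K}`:
for all `x ∈ Ñ_𝔤(H) ∩ Ñ_𝔤(K)` and all `c ∈ C̃_𝔤(H/K)`, one has `⁅x, c⁆ ∈ C̃_𝔤(H/K)`. -/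
theorem almostNormaliser_normalises_almostCentraliser
    (L : Type*) [LieRing L] (H K : AddSubgroup L) (hKH : K ≤ H)
    (x c : L)
    (hxH : almostLE (brkt x H) H) (hxK : almostLE (brkt x K) K)
    (hc : almostLE (brkt c H) K) :
    almostLE (brkt ⁅x, c⁆ H) K := by
  rw [almostLE_brkt_iff]
  refine mt (AddSubgroup.relIndex_eq_zero_of_le_left ?_) (AddSubgroup.relIndex_inf_ne_zero
    (almostLE_comap_comap hc hxK) (almostLE_comap_comap hxH hc))
  rintro h ⟨h₁, h₂⟩
  change ⁅x, ⁅c, h⁆⁆ ∈ K at h₁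
  change ⁅c, ⁅x, h⁆⁆ ∈ K at h₂
  change ⁅⁅x, c⁆, h⁆ ∈ K
  rw [lie_lie]
  exact K.sub_mem h₁ h₂
end

section
/- Let 𝔤 be a Lie ring and 𝔥 an almost ideal of 𝔤. Then the almost centre of 𝔥, namely Z̃(𝔥) = {y ∈ 𝔥 : the additive subgroup ⁅y,𝔥⁆ = {⁅y,h⁆ : h ∈ 𝔥} is finite}, is again an almost ideal of 𝔤 (this is the n = 1 case of the paper's lemma that every iterated almost centre Z̃_n(𝔥) of an almost ideal is an almost ideal). -/
theorem finite_brkt_iff {L : Type*} [LieRing L] (y : L) (H : AddSubgroup L) :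
    ((brkt y H : AddSubgroup L) : Set L).Finite ↔ (adHom L y).ker.relIndex H ≠ 0 := by
  rw [AddSubgroup.relIndex_ker, Nat.card_ne_zero]
  exact ⟨fun h => ⟨⟨0⟩, h⟩, fun h => h.2⟩

/-- The almost centre `{y ∈ H : ⁅y, H⁆ is finite}` of an additive subgroup of a Lie ring. -/
def almostCentre {L : Type*} [LieRing L] (H : AddSubgroup L) : AddSubgroup L where
  carrier := {y : L | y ∈ H ∧ ((brkt y H : AddSubgroup L) : Set L).Finite}
  zero_mem' := by
    refine ⟨H.zero_mem, (Set.finite_singleton (0 : L)).subset ?_⟩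
    rintro _ ⟨h, -, rfl⟩
    simp [adHom]
  add_mem' := by
    rintro a b ⟨ha, ha'⟩ ⟨hb, hb'⟩
    refine ⟨H.add_mem ha hb, (ha'.image2 (· + ·) hb').subset ?_⟩
    rintro _ ⟨h, hh, rfl⟩
    exact ⟨_, ⟨h, hh, rfl⟩, _, ⟨h, hh, rfl⟩, (add_lie a b h).symm⟩
  neg_mem' := by
    rintro a ⟨ha, ha'⟩
    refine ⟨H.neg_mem ha, (ha'.image (- ·)).subset ?_⟩
    rintro _ ⟨h, hh, rfl⟩
    exact ⟨_, ⟨h, hh, rfl⟩, (neg_lie a h).symm⟩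

/-- If `⁅x, H⁆ ⊆̃ H`, then `⁅x, z⁆` lies in the almost centre of `H` as soon as `z` does and
`⁅x, z⁆ ∈ H`. -/
theorem lie_mem_almostCentre {L : Type*} [LieRing L] {H : AddSubgroup L} {x z : L}
    (hx : almostLE (brkt x H) H) (hz : z ∈ almostCentre H) (hxz : ⁅x, z⁆ ∈ H) :
    ⁅x, z⁆ ∈ almostCentre H := by
  refine ⟨hxz, (finite_brkt_iff _ _).2 ?_⟩
  have hindex : (H.comap (adHom L x)).relIndex H ≠ 0 := by
    rw [AddSubgroup.relIndex_comap]
    exact hx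
  have hfin : (adHom L ⁅x, z⁆).ker.relIndex (H.comap (adHom L x) ⊓ H) ≠ 0 := by
    refine (finite_brkt_iff _ _).1
      ((Set.Finite.image2 (fun a b => ⁅x, a⁆ - b) hz.2 hz.2).subset ?_)
    rintro _ ⟨h, ⟨hxh, hh⟩, rfl⟩
    exact ⟨_, ⟨h, hh, rfl⟩, _, ⟨⁅x, h⁆, hxh, rfl⟩, (lie_lie x z h).symm⟩
  have hinf : ((adHom L ⁅x, z⁆).ker ⊓ H.comap (adHom L x)).relIndex H ≠ 0 := by
    rw [← AddSubgroup.relIndex_inf_mul_relIndex]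
    exact mul_ne_zero hfin hindex
  exact fun h0 => hinf (AddSubgroup.relIndex_eq_zero_of_le_left inf_le_left h0)

/-- Let `𝔤` be a Lie ring and `𝔥` an almost ideal of `𝔤` (an additive subgroup `H` with
`⁅x, H⁆ ⊆̃ H` for every `x ∈ 𝔤`).  Then the almost centre of `𝔥`, namely
`Z̃(𝔥) = {y ∈ 𝔥 : the additive subgroup ⁅y, 𝔥⁆ is finite}`, is again an almost ideal
of `𝔤`. -/
theorem almostCentre_of_almostIdeal_is_almostIdeal
    (L : Type*) [LieRing L] (H : AddSubgroup L)
    (hH : ∀ x : L, almostLE (brkt x H) H) :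
    ∃ Z : AddSubgroup L,
      ((Z : Set L) = {y : L | y ∈ H ∧ ((brkt y H : AddSubgroup L) : Set L).Finite}) ∧
      ∀ x : L, almostLE (brkt x Z) Z := by
  refine ⟨almostCentre H, rfl, fun x => ?_⟩
  have hle : brkt x (almostCentre H) ≤ brkt x H := AddSubgroup.map_mono fun _ hy => hy.1
  have hinf : almostCentre H ⊓ brkt x (almostCentre H) = H ⊓ brkt x (almostCentre H) := by
    refine le_antisymm (inf_le_inf_right _ fun _ hy => hy.1) ?_
    rintro _ ⟨hxz, z, hz, rfl⟩
    exact ⟨lie_mem_almostCentre (hH x) hz hxz, z, hz, rfl⟩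
  rw [almostLE, ← AddSubgroup.inf_relIndex_right, hinf, AddSubgroup.inf_relIndex_right]
  exact fun h0 => hH x (AddSubgroup.relIndex_eq_zero_of_le_right hle h0)
end

section
/- Let G be a connected abelian group (G has no proper subgroup of finite index), and let H₁, H₂ be subgroups with G = H₁ + H₂ and H₁ ∩ H₂ finite of cardinality m. Then every subgroup of finite index in H₁ has index at most m; in particular H₁ is virtually connected. -/
namespace AddSubgroup

variable {G : Type*} [AddCommGroup G]

/-- If `H₁ + H₂` is a connected abelian group, a finite index subgroup `K` of `H₁`
satisfies `K + H₂ = G`. -/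
theorem sup_eq_top_of_relIndex_ne_zero
    (hconn : ∀ K : AddSubgroup G, K.index ≠ 0 → K = ⊤) {H₁ H₂ K : AddSubgroup G}
    (hsum : H₁ ⊔ H₂ = ⊤) (hK : K ≤ H₁) (hK0 : K.relIndex H₁ ≠ 0) : K ⊔ H₂ = ⊤ := by
  apply hconn
  have htop : H₁ ⊔ (K ⊔ H₂) = ⊤ := by
    rw [← sup_assoc, sup_eq_left.mpr hK, hsum]
  rw [← relIndex_top_right, ← htop, relIndex_sup_right]
  exact fun h ↦ hK0 (relIndex_eq_zero_of_le_left le_sup_left h)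

/-- In a connected abelian group `H₁ + H₂` with `H₁ ∩ H₂` finite, the index of a finite index
subgroup of `H₁` is at most the cardinality of `H₁ ∩ H₂`. -/
theorem relIndex_le_card_inf_of_connected
    (hconn : ∀ K : AddSubgroup G, K.index ≠ 0 → K = ⊤) {H₁ H₂ K : AddSubgroup G}
    (hsum : H₁ ⊔ H₂ = ⊤) [Finite ↥(H₁ ⊓ H₂)] (hK : K ≤ H₁) (hK0 : K.relIndex H₁ ≠ 0) :
    K.relIndex H₁ ≤ Nat.card ↥(H₁ ⊓ H₂) := by
  have hmod : (H₁ ⊓ H₂) ⊔ K = H₁ := by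
    rw [sup_comm, inf_comm, ← sup_inf_assoc_of_le H₂ hK,
      sup_eq_top_of_relIndex_ne_zero hconn hsum hK hK0, top_inf_eq]
  have hindex : K.relIndex H₁ = K.relIndex (H₁ ⊓ H₂) := by
    rw [← relIndex_sup_right (H₁ ⊓ H₂) K, hmod]
  rw [hindex]
  exact Nat.le_of_dvd Nat.card_pos (relIndex_dvd_card _ _)

/-- If the finite indices of subgroups of `H` are bounded, then `H` has a smallest subgroup of
finite index. -/
theorem exists_least_relIndex_ne_zero_of_bounded {H : AddSubgroup G} {m : ℕ}
    (hbound : ∀ K : AddSubgroup G, K ≤ H → K.relIndex H ≠ 0 → K.relIndex H ≤ m) :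
    ∃ B : AddSubgroup G, B ≤ H ∧ B.relIndex H ≠ 0 ∧
      ∀ K : AddSubgroup G, K ≤ H → K.relIndex H ≠ 0 → B ≤ K := by
  let S : Set ℕ := {n | ∃ K : AddSubgroup G, K ≤ H ∧ K.relIndex H ≠ 0 ∧ K.relIndex H = n}
  have hne : S.Nonempty := ⟨_, H, le_rfl, by simp, rfl⟩
  have hbdd : BddAbove S := ⟨m, by rintro _ ⟨K, hK, hK0, rfl⟩; exact hbound K hK hK0⟩
  obtain ⟨B, hB, hB0, hmax⟩ := Nat.sSup_mem hne hbdd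
  refine ⟨B, hB, hB0, fun K hK hK0 ↦ ?_⟩
  have h0 : (B ⊓ K).relIndex H ≠ 0 := relIndex_inf_ne_zero hB0 hK0
  have hle : (B ⊓ K).relIndex H ≤ B.relIndex H :=
    hmax ▸ le_csSup hbdd ⟨B ⊓ K, inf_le_left.trans hB, h0, rfl⟩
  have hmul := relIndex_mul_relIndex (B ⊓ K) B H inf_le_left hB
  have hone : (B ⊓ K).relIndex B = 1 := by
    have hpos : (B ⊓ K).relIndex B ≠ 0 := fun h ↦ h0 (by rw [← hmul, h, zero_mul])
    have hB1 : 0 < B.relIndex H := Nat.pos_of_ne_zero hB0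
    have : (B ⊓ K).relIndex B ≤ 1 := by
      rw [← hmul] at hle
      exact Nat.le_of_mul_le_mul_right (by rwa [one_mul]) hB1
    omega
  exact (relIndex_eq_one.mp hone).trans inf_le_right

end AddSubgroup

/-- Let `G` be a connected abelian group (no proper subgroup of finite index), and let
`H₁`, `H₂` be subgroups with `G = H₁ + H₂` and `H₁ ∩ H₂` finite of cardinality `m`.
Then every subgroup of finite index in `H₁` has index at most `m`; in particular `H₁` is
virtually connected (it has a smallest subgroup of finite index). -/
theorem summand_of_connected_abelian_virtuallyConnected
    (G : Type*) [AddCommGroup G]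
    (hconn : ∀ K : AddSubgroup G, K.index ≠ 0 → K = ⊤)
    (H₁ H₂ : AddSubgroup G) (hsum : H₁ ⊔ H₂ = ⊤) (hfin : Finite ↥(H₁ ⊓ H₂)) :
    (∀ K : AddSubgroup G, K ≤ H₁ → K.relIndex H₁ ≠ 0 →
      K.relIndex H₁ ≤ Nat.card ↥(H₁ ⊓ H₂)) ∧
    ∃ B : AddSubgroup G, B ≤ H₁ ∧ B.relIndex H₁ ≠ 0 ∧
      ∀ K : AddSubgroup G, K ≤ H₁ → K.relIndex H₁ ≠ 0 → B ≤ K := by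
  have hbound : ∀ K : AddSubgroup G, K ≤ H₁ → K.relIndex H₁ ≠ 0 →
      K.relIndex H₁ ≤ Nat.card ↥(H₁ ⊓ H₂) :=
    fun _ ↦ AddSubgroup.relIndex_le_card_inf_of_connected hconn hsum
  exact ⟨hbound, AddSubgroup.exists_least_relIndex_ne_zero_of_bounded hbound⟩
end
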